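/- arXiv:1309.1035 — 3 statements merged into one kernel-verified Lean document; each statement's English description precedes it below -/
import Mathlib

section
/- Let R be a Noetherian commutative ring of characteristic p whose Frobenius r ↦ r^q is a finite ring map, and let S be an R-algebra that is essentially of finite type over R (a localization of a finite type R-algebra). Let M be a finitely generated S-module equipped with an additive map κ : M → M satisfying κ(s^q • m) = s • κ(m) for all s ∈ S, m ∈ M. Then, viewed as a Cartier module over R by restriction of scalars, M is ind-coherent over R: every element of M lies in a finitely generated R-submodule N of M with κ(N) ⊆ N. -/
/-- The `R`-span of the products of the vectors `e j` with the monomials in `x` whose exponents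
lie in `T`. -/
def monomialSpan (R : Type*) {S M ι J : Type*} [CommRing R] [CommRing S] [Fintype ι]
    [AddCommGroup M] [Module S M] [Module R M] (x : ι → S) (e : J → M) (T : Set (ι → ℕ)) :
    Submodule R M :=
  Submodule.span R (Set.image2 (fun m j => (∏ i, x i ^ m i) • e j) T Set.univ)

namespace monomialSpan

variable {R S M ι J : Type*} [CommRing R] [CommRing S] [Fintype ι]
  [AddCommGroup M] [Module S M] [Module R M] {x : ι → S} {e : J → M}

theorem mono {T T' : Set (ι → ℕ)} (h : T ⊆ T') :
    monomialSpan R x e T ≤ monomialSpan R x e T' :=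
  Submodule.span_mono (Set.image2_subset_right h)

theorem fg [Finite J] {T : Set (ι → ℕ)} (hT : T.Finite) : (monomialSpan R x e T).FG :=
  Submodule.fg_span (hT.image2 _ Set.finite_univ)

theorem monomial_smul_mem {T : Set (ι → ℕ)} {m : ι → ℕ} (hm : m ∈ T) (j : J) :
    (∏ i, x i ^ m i) • e j ∈ monomialSpan R x e T :=
  Submodule.subset_span ⟨m, hm, j, trivial, rfl⟩

theorem mem_univ (j : J) : e j ∈ monomialSpan R x e Set.univ := by
  simpa using monomial_smul_mem (R := R) (x := x) (e := e) (Set.mem_univ (0 : ι → ℕ)) j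

theorem exists_mem_Iic {y : M} (hy : y ∈ monomialSpan R x e Set.univ) :
    ∃ d : ℕ, y ∈ monomialSpan R x e (Set.Iic fun _ => d) := by
  induction hy using Submodule.span_induction with
  | mem y hy =>
    obtain ⟨m, -, j, -, rfl⟩ := hy
    have hm : m ∈ Set.Iic fun _ => ∑ i, m i := fun i =>
      Finset.single_le_sum (fun _ _ => Nat.zero_le _) (Finset.mem_univ i)
    exact ⟨∑ i, m i, monomial_smul_mem hm j⟩
  | zero => exact ⟨0, Submodule.zero_mem _⟩
  | add y z _ _ hy hz =>
    obtain ⟨a, ha⟩ := hy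
    obtain ⟨b, hb⟩ := hz
    exact ⟨max a b, add_mem (mono (Set.Iic_subset_Iic.2 fun _ => le_max_left a b) ha)
      (mono (Set.Iic_subset_Iic.2 fun _ => le_max_right a b) hb)⟩
  | smul r y _ hy =>
    obtain ⟨a, ha⟩ := hy
    exact ⟨a, Submodule.smul_mem _ r ha⟩

theorem exists_subset_Iic {F : Set M} (hF : F.Finite)
    (h : F ⊆ monomialSpan R x e Set.univ) :
    ∃ d : ℕ, F ⊆ monomialSpan R x e (Set.Iic fun _ => d) := by
  choose! f hf using fun y hy => exists_mem_Iic (h (a := y) hy)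
  obtain ⟨d, hd⟩ := (hF.image f).bddAbove
  exact ⟨d, fun y hy => mono (Set.Iic_subset_Iic.2 fun _ => hd ⟨y, hy, rfl⟩) (hf y hy)⟩

variable [Algebra R S] [IsScalarTower R S M]

theorem smul_mem_of_forall {T : Set (ι → ℕ)} {N : Submodule R M} {a : S}
    (h : ∀ m ∈ T, ∀ j, a • (∏ i, x i ^ m i) • e j ∈ N) {y : M}
    (hy : y ∈ monomialSpan R x e T) : a • y ∈ N := by
  have : monomialSpan R x e T ≤ N.comap (Algebra.lsmul R R M a) := by
    refine Submodule.span_le.2 ?_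
    rintro _ ⟨m, hm, j, -, rfl⟩
    exact h m hm j
  exact this hy

theorem monomial_smul_mem_add {T T' : Set (ι → ℕ)} {b : ι → ℕ} (h : ∀ m ∈ T, b + m ∈ T')
    {y : M} (hy : y ∈ monomialSpan R x e T) :
    (∏ i, x i ^ b i) • y ∈ monomialSpan R x e T' := by
  refine smul_mem_of_forall (fun m hm j => ?_) hy
  rw [smul_smul, ← Finset.prod_mul_distrib]
  simp only [← pow_add]
  exact monomial_smul_mem (h m hm) j

theorem adjoin_smul_mem {a : S} (ha : a ∈ Algebra.adjoin R (Set.range x)) {y : M}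
    (hy : y ∈ monomialSpan R x e Set.univ) : a • y ∈ monomialSpan R x e Set.univ := by
  classical
  induction ha using Algebra.adjoin_induction generalizing y with
  | mem a ha =>
    obtain ⟨i, rfl⟩ := ha
    simpa [Pi.single_apply, pow_ite] using monomial_smul_mem_add (R := R) (x := x) (e := e)
      (b := Pi.single i 1) (T' := Set.univ) (fun _ _ => Set.mem_univ _) hy
  | algebraMap r => simpa using Submodule.smul_mem _ r hy
  | add a b _ _ ha hb => rw [add_smul]; exact add_mem (ha hy) (hb hy)
  | mul a b _ _ ha hb => rw [mul_smul]; exact ha (hb hy)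

theorem smul_mem_smul {T : Set (ι → ℕ)} (u : S) {y : M} (hy : y ∈ monomialSpan R x e T) :
    u • y ∈ monomialSpan R x (fun j => u • e j) T := by
  refine smul_mem_of_forall (fun m hm j => ?_) hy
  rw [smul_comm]
  exact monomial_smul_mem (e := fun j => u • e j) hm j

/-- A `q⁻¹`-linear map on a span of monomials is controlled by its values on the monomials with
exponents less than `q`, multiplied by generators of `R` over its subring of `q`-th powers. -/
theorem map_mem {q : ℕ} (hq : 0 < q) (κ : M →+ M)
    (hκ : ∀ (t : S) (m : M), κ (t ^ q • m) = t • κ m)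
    {G : Finset R} (hG : ∀ r : R, ∃ f : R → R, r = ∑ g ∈ G, f g ^ q * g)
    {T : Set (ι → ℕ)} {N N' : Submodule R M}
    (hN : ∀ c : ι → ℕ, (∀ i, c i < q) → ∀ g ∈ G, ∀ j,
      κ (g • (∏ i, x i ^ c i) • e j) ∈ N)
    (hN' : ∀ m ∈ T, ∀ y ∈ N, (∏ i, x i ^ (m i / q)) • y ∈ N')
    {y : M} (hy : y ∈ monomialSpan R x e T) : κ y ∈ N' := by
  induction hy using Submodule.closure_induction with
  | zero => simp
  | add y z _ _ hy hz => rw [map_add]; exact add_mem hy hz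
  | smul_mem r y hy =>
    obtain ⟨m, hm, j, -, rfl⟩ := hy
    obtain ⟨f, hf⟩ := hG r
    rw [hf, Finset.sum_smul, map_sum]
    refine sum_mem fun g hg => ?_
    have hm' : ∏ i, x i ^ m i = (∏ i, x i ^ (m i / q)) ^ q * ∏ i, x i ^ (m i % q) := by
      rw [← Finset.prod_pow, ← Finset.prod_mul_distrib]
      refine Finset.prod_congr rfl fun i _ => ?_
      rw [← pow_mul, ← pow_add, mul_comm, Nat.div_add_mod]
    have key : (f g ^ q * g) • (∏ i, x i ^ m i) • e j =
        (algebraMap R S (f g) * ∏ i, x i ^ (m i / q)) ^ q •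
          (g • (∏ i, x i ^ (m i % q)) • e j) := by
      simp only [hm', ← algebraMap_smul S (_ : R) (_ : M), smul_smul, map_mul, map_pow]
      congr 1
      ring
    rw [key, hκ, mul_smul, algebraMap_smul]
    exact Submodule.smul_mem _ _
      (hN' m hm _ (hN _ (fun i => Nat.mod_lt _ hq) g hg j))

/-- If the vectors `e j` generate `M` over an algebra `S` in which every element is a fraction of
elements of `R[x]`, then finitely many elements of `M` have a common denominator. -/
theorem exists_denominator
    (hx : ∀ t : S, ∃ w ∈ Algebra.adjoin R (Set.range x),
      IsUnit w ∧ w * t ∈ Algebra.adjoin R (Set.range x))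
    (he : Submodule.span S (Set.range e) = ⊤) {F : Set M} (hF : F.Finite) :
    ∃ w ∈ Algebra.adjoin R (Set.range x), IsUnit w ∧
      ∀ y ∈ F, w • y ∈ monomialSpan R x e Set.univ := by
  have single (y : M) : ∃ w ∈ Algebra.adjoin R (Set.range x), IsUnit w ∧
      w • y ∈ monomialSpan R x e Set.univ := by
    have hy : y ∈ Submodule.span S (Set.range e) := he ▸ Submodule.mem_top
    induction hy using Submodule.span_induction with
    | mem y hy =>
      obtain ⟨j, rfl⟩ := hy
      exact ⟨1, one_mem _, isUnit_one, by simpa using mem_univ j⟩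
    | zero => exact ⟨1, one_mem _, isUnit_one, by simp⟩
    | add y z _ _ hy hz =>
      obtain ⟨v, hv, hvu, hvy⟩ := hy
      obtain ⟨w, hw, hwu, hwz⟩ := hz
      refine ⟨v * w, mul_mem hv hw, hvu.mul hwu, ?_⟩
      rw [smul_add]
      refine add_mem ?_ ?_
      · rw [mul_comm, mul_smul]; exact adjoin_smul_mem hw hvy
      · rw [mul_smul]; exact adjoin_smul_mem hv hwz
    | smul t y _ hy =>
      obtain ⟨v, hv, hvu, hvy⟩ := hy
      obtain ⟨w, hw, hwu, hwt⟩ := hx t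
      refine ⟨w * v, mul_mem hw hv, hwu.mul hvu, ?_⟩
      rw [smul_smul, mul_right_comm, mul_smul]
      exact adjoin_smul_mem hwt hvy
  induction F, hF using Set.Finite.induction_on with
  | empty => exact ⟨1, one_mem _, isUnit_one, by simp⟩
  | insert _ _ ih =>
    rename_i a F _ _
    obtain ⟨v, hv, hvu, hvy⟩ := ih
    obtain ⟨w, hw, hwu, hwa⟩ := single a
    refine ⟨v * w, mul_mem hv hw, hvu.mul hwu, ?_⟩
    rintro y (rfl | hy)
    · rw [mul_smul]; exact adjoin_smul_mem hv hwa
    · rw [mul_comm, mul_smul]; exact adjoin_smul_mem hw (hvy y hy)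

end monomialSpan

/-- A ring which is finite along its `q`-th power endomorphism is a finite sum of multiples of
`q`-th powers. -/
theorem RingHom.Finite.exists_eq_sum_pow_mul {R : Type*} [CommRing R] {φ : R →+* R} {q : ℕ}
    (hfin : φ.Finite) (hφ : ∀ r : R, φ r = r ^ q) :
    ∃ G : Finset R, ∀ r : R, ∃ f : R → R, r = ∑ g ∈ G, f g ^ q * g := by
  let _ := φ.toAlgebra.toModule
  obtain ⟨G, hG⟩ := hfin.fg_top
  refine ⟨G, fun r => ?_⟩
  obtain ⟨f, -, hf⟩ := Submodule.mem_span_finset.1 (hG ▸ Submodule.mem_top (x := r))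
  simp_rw [← hφ]
  exact ⟨f, hf.symm⟩

/-- Corollary 3.2.15 (affine form): for a finitely generated Cartier module `M` over an
essentially finite type `R`-algebra `S` (with `R` Noetherian of characteristic `p` with
finite Frobenius), `M` is ind-coherent as a Cartier module over `R`: every element lies in a
finitely generated `κ`-stable `R`-submodule. -/
theorem stmt_9 {R : Type*} [CommRing R] [IsNoetherianRing R]
    (p : ℕ) (hp : p.Prime) [CharP R p] (s : ℕ) (hs : 1 ≤ s) (q : ℕ) (hq : q = p ^ s)
    (φ : R →+* R) (hφ : ∀ r : R, φ r = r ^ q) (hfin : φ.Finite)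
    {S : Type*} [CommRing S] [Algebra R S] [Algebra.EssFiniteType R S]
    {M : Type*} [AddCommGroup M] [Module S M] [Module R M]
    [IsScalarTower R S M] [Module.Finite S M]
    (κ : M → M) (hadd : ∀ x y : M, κ (x + y) = κ x + κ y)
    (hκ : ∀ (t : S) (m : M), κ (t ^ q • m) = t • κ m) :
    ∀ m : M, ∃ N : Submodule R M, N.FG ∧ (∀ x ∈ N, κ x ∈ N) ∧ m ∈ N := by
  classical
  have hq2 : 2 ≤ q := hq ▸ hp.two_le.trans (Nat.le_self_pow (by omega) p)
  obtain ⟨G, hG⟩ := hfin.exists_eq_sum_pow_mul hφ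
  obtain ⟨n, e, he⟩ := Module.Finite.exists_fin (R := S) (M := M)
  let k : M →+ M := AddMonoidHom.mk' κ hadd
  let x : Algebra.EssFiniteType.finset R S → S := Subtype.val
  have hadj : Algebra.adjoin R (Set.range x) = Algebra.EssFiniteType.subalgebra R S := by
    simp [x, Algebra.EssFiniteType.subalgebra]
  have hx (t : S) : ∃ w ∈ Algebra.adjoin R (Set.range x),
      IsUnit w ∧ w * t ∈ Algebra.adjoin R (Set.range x) := by
    rw [hadj]
    obtain ⟨⟨a, w⟩, h⟩ := IsLocalization.surj (Algebra.EssFiniteType.submonoid R S) t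
    refine ⟨w.1, w.1.2, IsLocalization.map_units S w, ?_⟩
    rw [mul_comm]
    exact h ▸ a.2
  have hfinite (e : Fin n → M) : {y | ∃ c : _ → ℕ, (∀ i, c i < q) ∧ ∃ g ∈ G, ∃ j,
      k (g • (∏ i, x i ^ c i) • e j) = y}.Finite := by
    have hc : {c : Algebra.EssFiniteType.finset R S → ℕ | ∀ i, c i < q}.Finite :=
      (Set.finite_Iic fun _ => q).subset fun c h i => (h i).le
    refine ((hc.prod (G.finite_toSet.prod (Set.finite_univ (α := Fin n)))).image
      fun z => k (z.2.1 • (∏ i, x i ^ z.1 i) • e z.2.2)).subset ?_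
    rintro _ ⟨c, hc, g, hg, j, rfl⟩
    exact ⟨(c, g, j), ⟨hc, hg, trivial⟩, rfl⟩
  intro m
  obtain ⟨w, hw, hwu, hwF⟩ := monomialSpan.exists_denominator hx he ((hfinite e).insert m)
  obtain ⟨u, huw⟩ := hwu.exists_left_inv
  have hmem {y : M} (hy : y ∈ monomialSpan R x e Set.univ) :
      w • κ y ∈ monomialSpan R x e Set.univ := by
    refine monomialSpan.map_mem (by omega) k hκ hG (T := Set.univ)
      (N := (monomialSpan R x e Set.univ).comap (Algebra.lsmul R R M w))
      (N' := (monomialSpan R x e Set.univ).comap (Algebra.lsmul R R M w))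
      (fun c hc g hg j => hwF _ (Or.inr ⟨c, hc, g, hg, j, rfl⟩)) (fun b _ y hy => ?_) hy
    change w • (∏ i, x i ^ (b i / q)) • y ∈ monomialSpan R x e Set.univ
    rw [smul_comm]
    exact monomialSpan.monomial_smul_mem_add (b := fun i => b i / q)
      (fun _ _ => Set.mem_univ _) hy
  let e' : Fin n → M := fun j => u ^ 2 • e j
  have hstab {y : M} (hy : y ∈ monomialSpan R x e Set.univ) :
      κ (u ^ 2 • y) ∈ monomialSpan R x e' Set.univ := by
    have h : u ^ 2 • y = (u ^ 2 * w) ^ q • w ^ (q - 2) • y := by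
      obtain ⟨l, rfl⟩ := Nat.exists_eq_add_of_le hq2
      rw [smul_smul, Nat.add_sub_cancel_left]
      congr 1
      calc u ^ 2 = u ^ 2 * (u * w) ^ (2 * l + 2) := by rw [huw]; simp
        _ = _ := by ring
    rw [h, hκ, mul_smul]
    exact monomialSpan.smul_mem_smul _
      (hmem (monomialSpan.adjoin_smul_mem (pow_mem hw _) hy))
  have hm : m ∈ monomialSpan R x e' Set.univ := by
    have h : m = u ^ 2 • w • w • m := by
      rw [smul_smul, smul_smul, show u ^ 2 * w * w = (u * w) ^ 2 by ring, huw, one_pow, one_smul]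
    rw [h]
    exact monomialSpan.smul_mem_smul _
      (monomialSpan.adjoin_smul_mem hw (hwF _ (Set.mem_insert _ _)))
  obtain ⟨d, hd⟩ := monomialSpan.exists_subset_Iic (R := R) (x := x) (e := e')
    ((hfinite e').insert m) (by
      rintro _ (rfl | ⟨c, hc, g, hg, j, rfl⟩)
      · exact hm
      · have h : g • (∏ i, x i ^ c i) • e' j = u ^ 2 • g • (∏ i, x i ^ c i) • e j := by
          simp only [e', ← algebraMap_smul S g, smul_smul]
          congr 1
          ring
        rw [h]
        exact hstab (Submodule.smul_mem _ g
          (monomialSpan.monomial_smul_mem (Set.mem_univ _) j)))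
  refine ⟨monomialSpan R x e' (Set.Iic fun _ => 2 * d), monomialSpan.fg (Set.finite_Iic _),
    fun y hy => ?_, monomialSpan.mono (Set.Iic_subset_Iic.2 fun _ => Nat.le_mul_of_pos_left d two_pos)
      (hd (Set.mem_insert _ _))⟩
  refine monomialSpan.map_mem (by omega) k hκ hG
    (fun c hc g hg j => hd (Or.inr ⟨c, hc, g, hg, j, rfl⟩)) (fun b hb y hy => ?_) hy
  refine monomialSpan.monomial_smul_mem_add (b := fun i => b i / q) (fun a ha => ?_) hy
  intro i
  have h₁ : b i / q ≤ b i / 2 := Nat.div_le_div_left hq2 (by omega)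
  have h₂ : b i ≤ 2 * d := hb i
  have h₃ : a i ≤ d := ha i
  change b i / q + a i ≤ 2 * d
  omega
end

section
/- Let R be a commutative ring of characteristic p, I ⊆ R an ideal, and M a Cartier module (M, κ) over R such that every element of M is annihilated by some power of I. Let M[I] := {m ∈ M : r • m = 0 for all r ∈ I}. Then M[I] is a κ-submodule of M, and the quotient M/M[I] is locally nilpotent; more precisely, for every finitely generated R-submodule U of M there exists e ≥ 0 with κ^e(U) ⊆ M[I] (indeed any e with q^e ≥ n works if I^n annihilates U). -/
/-- The iterates of a `q`-inverse-linear map are `q ^ e`-inverse-linear. -/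
theorem iterate_pow_smul {R M : Type*} [Monoid R] [SMul R M] {q : ℕ} {κ : M → M}
    (hκ : ∀ (r : R) (m : M), κ (r ^ q • m) = r • κ m) (e : ℕ) (r : R) (m : M) :
    κ^[e] (r ^ q ^ e • m) = r • κ^[e] m := by
  induction e generalizing m with
  | zero => simp
  | succ e ih =>
    rw [Function.iterate_succ_apply, Function.iterate_succ_apply, pow_succ, pow_mul, hκ, ih]

/-- A finitely generated module whose elements are each annihilated by a power of `I` is
annihilated by a single power of `I`. -/
theorem Submodule.FG.exists_le_torsionBySet_pow {R M : Type*} [CommRing R] [AddCommGroup M]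
    [Module R M] {I : Ideal R} (htors : ∀ m : M, ∃ n : ℕ, ∀ r ∈ I ^ n, r • m = 0)
    {U : Submodule R M} (hU : U.FG) :
    ∃ n : ℕ, U ≤ Submodule.torsionBySet R M (I ^ n : Ideal R) := by
  have mono {a b : ℕ} (h : a ≤ b) : Submodule.torsionBySet R M (I ^ a : Ideal R) ≤
      Submodule.torsionBySet R M (I ^ b : Ideal R) :=
    Submodule.torsionBySet_le_torsionBySet_of_subset (Ideal.pow_le_pow_right h)
  induction U, hU using Submodule.fg_induction with
  | singleton x =>
    obtain ⟨n, hn⟩ := htors x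
    refine ⟨n, ?_⟩
    rw [Submodule.span_singleton_le_iff_mem, Submodule.mem_torsionBySet_iff]
    exact fun a => hn a a.2
  | sup A B _ _ hA hB =>
    obtain ⟨a, ha⟩ := hA
    obtain ⟨b, hb⟩ := hB
    exact ⟨max a b, sup_le (ha.trans (mono (le_max_left a b))) (hb.trans (mono (le_max_right a b)))⟩


/-- Key computation in the proof of Theorem 4.1.1: for a Cartier module `M` over `R` all of
whose elements are annihilated by a power of an ideal `I`, the `I`-torsion part `M[I]` is a
`κ`-submodule and `M/M[I]` is locally nilpotent; indeed `κ^e` maps a submodule annihilated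
by `I^n` into `M[I]` whenever `q^e ≥ n`. -/
theorem stmt_10 {R M : Type*} [CommRing R] [AddCommGroup M] [Module R M]
    (p : ℕ) (hp : p.Prime) [CharP R p] (s : ℕ) (hs : 1 ≤ s) (q : ℕ) (hq : q = p ^ s)
    (κ : M → M) (hadd : ∀ x y : M, κ (x + y) = κ x + κ y)
    (hκ : ∀ (r : R) (m : M), κ (r ^ q • m) = r • κ m)
    (I : Ideal R)
    (htors : ∀ m : M, ∃ n : ℕ, ∀ r ∈ I ^ n, r • m = 0) :
    ∃ MI : Submodule R M,
      (∀ m : M, m ∈ MI ↔ ∀ r ∈ I, r • m = 0) ∧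
      (∀ m ∈ MI, κ m ∈ MI) ∧
      (∀ U : Submodule R M, U.FG → ∃ e : ℕ, ∀ u ∈ U, κ^[e] u ∈ MI) ∧
      (∀ (U : Submodule R M) (n e : ℕ), (∀ u ∈ U, ∀ r ∈ I ^ n, r • u = 0) →
        n ≤ q ^ e → ∀ u ∈ U, κ^[e] u ∈ MI) := by
  have hq2 : 1 < q := hq ▸ Nat.one_lt_pow (by omega) hp.one_lt
  have h0 : κ 0 = 0 := by simpa using hadd 0 0
  have mem (m : M) : m ∈ Submodule.torsionBySet R M (I : Set R) ↔ ∀ r ∈ I, r • m = 0 := by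
    simp [Submodule.mem_torsionBySet_iff]
  have key (U : Submodule R M) (n e : ℕ) (hU : ∀ u ∈ U, ∀ r ∈ I ^ n, r • u = 0)
      (hn : n ≤ q ^ e) : ∀ u ∈ U, κ^[e] u ∈ Submodule.torsionBySet R M (I : Set R) := by
    intro u hu
    rw [mem]
    intro r hr
    rw [← iterate_pow_smul hκ, hU u hu _ (Ideal.pow_le_pow_right hn (Ideal.pow_mem_pow hr _)),
      Function.iterate_fixed h0]
  refine ⟨Submodule.torsionBySet R M (I : Set R), mem, fun m hm => ?_, fun U hU => ?_, key⟩
  · rw [mem] at hm ⊢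
    intro r hr
    rw [← hκ, hm _ (Ideal.pow_mem_of_mem I hr q (by omega)), h0]
  · obtain ⟨n, hn⟩ := hU.exists_le_torsionBySet_pow htors
    exact ⟨n, key U n n (fun u hu r hr => (Submodule.mem_torsionBySet_iff _ _).1 (hn hu) ⟨r, hr⟩)
      (Nat.lt_pow_self hq2).le⟩
end

section
/- Let A be a Noetherian commutative ring and σ : A → A a ring homomorphism whose induced map on prime spectra (the comap of σ) is bijective. Let M be a σ-Cartier module which contains a finitely generated κ-stable A-submodule C such that M/C is locally nilpotent. Suppose φ_1 : M → N_1 and φ_2 : M → N_2 are A-linear maps commuting with the κ's, with N_1, N_2 finitely generated σ-Cartier modules, such that the kernels and cokernels of φ_1 and φ_2 are locally nilpotent. Then ⋂_{e≥0} Supp(κ^e(N_1)) = ⋂_{e≥0} Supp(κ^e(N_2)); i.e., the crystalline support of M is well defined. -/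
open Function in
/-- An injective monotone self-map of a well-founded partial order preserves a finite antichain
`S` as soon as every element of `S` lies above the image of some element of `S`. -/
theorem Monotone.mapsTo_of_finite_isAntichain {α : Type*} [PartialOrder α] [WellFoundedLT α]
    {f : α → α} (hf : Monotone f) (hinj : Injective f) {S : Set α} (hS : S.Finite)
    (hanti : IsAntichain (· ≤ ·) S) (h : ∀ p ∈ S, ∃ q ∈ S, f q ≤ p) : Set.MapsTo f S S := by
  have hfix {F : α → α} (hF : Monotone F) (hFi : Injective F) {p : α} (hp : F p ≤ p) :
      F p = p := by
    have hanti : Antitone fun n ↦ F^[n] p := antitone_nat_of_succ_le fun n ↦ by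
      rw [iterate_succ_apply]
      exact hF.iterate n hp
    obtain ⟨n, hn⟩ := WellFoundedLT.antitone_chain_condition hanti
    have := hn (n + 1) n.le_succ
    simp only [iterate_succ_apply] at this
    exact (hFi.iterate n this).symm
  have := hS.to_subtype
  choose g hgS hg using h
  let G : S → S := fun p ↦ ⟨g p p.2, hgS p p.2⟩
  have hG (p : S) : f (G p) ≤ p := hg p p.2
  have hper (p : S) (hp : p ∈ periodicPts G) : f (G p) = p := by
    obtain ⟨k, hk, hkp⟩ := mem_periodicPts.1 hp
    have hle : Antitone fun n ↦ f^[n] (G^[n] p : S) := antitone_nat_of_succ_le fun n ↦ by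
      rw [iterate_succ_apply, iterate_succ_apply']
      exact hf.iterate n (hG _)
    have h1 : f^[k] p ≤ f (G p) := by
      have := hle (show 1 ≤ k from hk)
      simpa only [hkp.eq, iterate_one] using this
    refine (hG p).antisymm ?_
    rwa [hfix (hf.iterate k) (hinj.iterate k) (h1.trans (hG p))] at h1
  have hback (p : S) (hp : G p ∈ periodicPts G) : p ∈ periodicPts G := by
    obtain ⟨t, ht, hte⟩ := (bijOn_periodicPts G).surjOn hp
    have htp : (t : α) ≤ p := by
      rw [← hper t ht, hte]
      exact hG p
    rwa [← Subtype.ext (hanti.eq t.2 p.2 htp)]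
  have hall (p : S) : p ∈ periodicPts G := by
    have hn (n : ℕ) : G^[n] p ∈ periodicPts G → p ∈ periodicPts G := by
      induction n with
      | zero => exact id
      | succ n ih =>
        rw [iterate_succ_apply']
        exact fun h ↦ ih (hback _ h)
    obtain ⟨m, n, hmn, he⟩ : ∃ m n, m < n ∧ G^[m] p = G^[n] p := by
      obtain ⟨m, n, hne, he⟩ := Finite.exists_ne_map_eq_of_infinite fun n ↦ G^[n] p
      rcases hne.lt_or_gt with h | h
      exacts [⟨m, n, h, he⟩, ⟨n, m, h, he.symm⟩]
    refine hn m (mk_mem_periodicPts (n := n - m) (by omega) ?_)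
    rw [IsPeriodicPt, IsFixedPt, ← iterate_add_apply, Nat.sub_add_cancel hmn.le, he]
  intro p hp
  obtain ⟨q, -, hq⟩ := (bijOn_periodicPts G).surjOn (hall ⟨p, hp⟩)
  have := hper q (hall q)
  rw [hq] at this
  exact this ▸ q.2

theorem PrimeSpectrum.wellFoundedLT_of_isNoetherianRing (A : Type*) [CommRing A]
    [IsNoetherianRing A] : WellFoundedLT (PrimeSpectrum A) :=
  StrictMono.wellFoundedLT (f := fun p : PrimeSpectrum A ↦ p.asIdeal.height)
    fun _ _ h ↦ Ideal.height_strict_mono_of_isPrime h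

/-- Over a Noetherian ring, an injective `comap σ` preserves a closed set `V(I)` which is
contained in the closure of its image. -/
theorem PrimeSpectrum.mapsTo_comap_zeroLocus {A : Type*} [CommRing A] [IsNoetherianRing A]
    {σ : A →+* A} (hσ : Function.Injective (comap σ)) {I : Ideal A} (hI : I.comap σ ≤ I) :
    Set.MapsTo (comap σ) (zeroLocus (I : Set A)) (zeroLocus I) := by
  have := wellFoundedLT_of_isNoetherianRing A
  have hmono : Monotone (comap σ) := fun p q h ↦ Ideal.comap_mono (f := σ) h
  have hmaps := hmono.mapsTo_of_finite_isAntichain hσ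
    (S := {p : PrimeSpectrum A | p.asIdeal ∈ I.minimalPrimes})
    (I.finite_minimalPrimes_of_isNoetherianRing.preimage
      fun p _ q _ h ↦ PrimeSpectrum.ext h)
    (fun p hp q hq hne hle ↦ hne (PrimeSpectrum.ext (le_antisymm hle (hq.2 hp.1 hle))))
    (fun p hp ↦ by
      obtain ⟨q, hIq, hq, hqp⟩ :=
        Ideal.exists_ideal_comap_le_prime (f := σ) p.asIdeal I (hI.trans hp.1.2)
      obtain ⟨r, hr, hrq⟩ := Ideal.exists_minimalPrimes_le hIq
      exact ⟨⟨r, hr.1.1⟩, hr, (Ideal.comap_mono hrq).trans hqp⟩)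
  intro p hp
  obtain ⟨q, hq, hqp⟩ := Ideal.exists_minimalPrimes_le (J := p.asIdeal) hp
  exact (hmaps (show (⟨q, hq.1.1⟩ : PrimeSpectrum A) ∈ _ from hq)).1.2.trans
    (Ideal.comap_mono hqp)

/-- A Cartier-type additive map which is locally nilpotent modulo `Q` on a finitely generated
submodule is nilpotent modulo `Q` on it. -/
theorem Submodule.FG.exists_iterate_mem {A M : Type*} [CommRing A] [AddCommGroup M] [Module A M]
    {κ : M → M} (hadd : ∀ x y, κ (x + y) = κ x + κ y) {Q : Submodule A M}
    (hQ : ∀ x ∈ Q, κ x ∈ Q) {D : Submodule A M} (hD : D.FG)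
    (h : ∀ m ∈ D, ∃ P : Submodule A M, m ∈ P ∧ ∃ e : ℕ, ∀ x ∈ P, κ^[e] x ∈ Q) :
    ∃ e : ℕ, ∀ x ∈ D, κ^[e] x ∈ Q := by
  have hstep {x : M} {i j : ℕ} (hij : i ≤ j) (hx : κ^[i] x ∈ Q) : κ^[j] x ∈ Q := by
    induction j, hij using Nat.le_induction with
    | base => exact hx
    | succ j _ ih =>
      rw [Function.iterate_succ_apply']
      exact hQ _ ih
  have hadd' (e : ℕ) (x y : M) : κ^[e] (x + y) = κ^[e] x + κ^[e] y :=
    iterate_map_add (AddMonoidHom.mk' κ hadd) e x y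
  induction D, hD using Submodule.fg_induction with
  | singleton x =>
    obtain ⟨P, hxP, e, he⟩ := h x (mem_span_singleton_self x)
    exact ⟨e, fun y hy ↦ he y ((span_singleton_le_iff_mem x P).2 hxP hy)⟩
  | sup D₁ D₂ _ _ ih₁ ih₂ =>
    obtain ⟨e₁, h₁⟩ := ih₁ fun m hm ↦ h m (mem_sup_left hm)
    obtain ⟨e₂, h₂⟩ := ih₂ fun m hm ↦ h m (mem_sup_right hm)
    refine ⟨max e₁ e₂, fun x hx ↦ ?_⟩
    obtain ⟨y, hy, z, hz, rfl⟩ := mem_sup.1 hx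
    rw [hadd']
    exact Q.add_mem (hstep (le_max_left _ _) (h₁ y hy)) (hstep (le_max_right _ _) (h₂ z hz))

/-- The crystalline support can be computed on a finitely generated `κ`-stable submodule `C` of
the source of a nil-isomorphism, provided `C` has locally nilpotent quotient. -/
theorem mem_iInter_support_iff_of_nilIsomorphism {A : Type*} [CommRing A] [IsNoetherianRing A]
    {σ : A →+* A} (hσ : Function.Injective (PrimeSpectrum.comap σ))
    {M N : Type*} [AddCommGroup M] [Module A M] [AddCommGroup N] [Module A N] [Module.Finite A N]
    {κ : M → M} {κ' : N → N}
    (hadd : ∀ x y : M, κ (x + y) = κ x + κ y)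
    (hκ : ∀ (a : A) (m : M), κ (σ a • m) = a • κ m)
    (hadd' : ∀ x y : N, κ' (x + y) = κ' x + κ' y)
    {C : Submodule A M} (hCfg : C.FG) (hCκ : ∀ x ∈ C, κ x ∈ C)
    (hC : ∀ m : M, ∃ P : Submodule A M, m ∈ P ∧ ∃ e : ℕ, ∀ x ∈ P, κ^[e] x ∈ C)
    {φ : M →ₗ[A] N} (hφκ : ∀ x : M, φ (κ x) = κ' (φ x))
    (hker : ∀ m ∈ LinearMap.ker φ, ∃ P : Submodule A M, m ∈ P ∧ ∃ e : ℕ, ∀ x ∈ P, κ^[e] x = 0)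
    (hcoker : ∀ y : N, ∃ P : Submodule A N, y ∈ P ∧
      ∃ e : ℕ, ∀ x ∈ P, κ'^[e] x ∈ LinearMap.range φ)
    {K : ℕ → Submodule A N} (hK : ∀ e : ℕ, (K e : Set N) = Set.range (κ'^[e]))
    (p : PrimeSpectrum A) :
    (p ∈ ⋂ e : ℕ, Module.support A ↥(K e)) ↔
      ∀ e : ℕ, ∃ c ∈ C, ∀ r ∉ p.asIdeal, r • κ^[e] c ≠ 0 := by
  have hφe (e : ℕ) (x : M) : φ (κ^[e] x) = κ'^[e] (φ x) :=
    (Function.Semiconj.iterate_right (f := φ) hφκ e) x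
  have hκe (e : ℕ) (a : A) (m : M) : κ^[e] ((σ ^ e) a • m) = a • κ^[e] m := by
    induction e generalizing a m with
    | zero => rfl
    | succ e ih =>
      rw [pow_succ', Function.iterate_succ_apply, Function.iterate_succ_apply, RingHom.mul_def,
        RingHom.comp_apply, hκ, ih]
  have hCe (e : ℕ) (x : M) (hx : x ∈ C) : κ^[e] x ∈ C :=
    Set.MapsTo.iterate (f := κ) (s := C) hCκ e hx
  have hκ0 : κ 0 = 0 := (AddMonoidHom.mk' κ hadd).map_zero
  obtain ⟨e₀, he₀⟩ : ∃ e, ∀ y : N, κ'^[e] y ∈ C.map φ := by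
    obtain ⟨e₁, he₁⟩ := (Module.Finite.fg_top (R := A) (M := N)).exists_iterate_mem hadd'
      (Q := LinearMap.range φ) (by rintro _ ⟨x, rfl⟩; exact ⟨κ x, hφκ x⟩) fun y _ ↦ hcoker y
    obtain ⟨e₂, he₂⟩ := (IsNoetherian.noetherian (LinearMap.range φ)).exists_iterate_mem hadd'
      (Q := C.map φ) (by rintro _ ⟨x, hx, rfl⟩; exact ⟨κ x, hCκ x hx, hφκ x⟩) (by
        rintro _ ⟨m, rfl⟩
        obtain ⟨P, hmP, e, he⟩ := hC m
        refine ⟨P.map φ, ⟨m, hmP, rfl⟩, e, ?_⟩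
        rintro _ ⟨x, hx, rfl⟩
        exact ⟨κ^[e] x, he x hx, hφe e x⟩)
    refine ⟨e₂ + e₁, fun y ↦ ?_⟩
    rw [Function.iterate_add_apply]
    exact he₂ _ (he₁ y trivial)
  obtain ⟨d, hd⟩ : ∃ d, ∀ x ∈ LinearMap.ker φ ⊓ C, κ^[d] x ∈ (⊥ : Submodule A M) := by
    have := isNoetherian_of_fg_of_noetherian C hCfg
    refine Submodule.FG.exists_iterate_mem hadd (by simp [hκ0])
      (isNoetherian_submodule.1 this _ inf_le_right) fun m hm ↦ ?_
    simpa using hker m hm.1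
  simp only [Set.mem_iInter]
  constructor
  · intro hp e
    obtain ⟨⟨y, hy⟩, hr⟩ := Module.mem_support_iff'.1 (hp (e + e₀))
    rw [← SetLike.mem_coe, hK] at hy
    obtain ⟨y, rfl⟩ := hy
    obtain ⟨c, hc, hcy⟩ := he₀ y
    refine ⟨c, hc, fun r hrp h0 ↦ hr r hrp (Subtype.ext ?_)⟩
    simp only [Submodule.coe_smul, Submodule.coe_zero]
    rw [Function.iterate_add_apply, ← hcy, ← hφe, ← map_smul, h0, map_zero]
  · intro hp
    let J (e : ℕ) : Ideal A := (Submodule.span A ((fun c ↦ φ (κ^[e] c)) '' C)).annihilator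
    have hJ (e : ℕ) (r : A) : r ∈ J e ↔ ∀ c ∈ C, r • φ (κ^[e] c) = 0 := by
      simp [J, Submodule.mem_annihilator_span]
    have hJmono : Monotone J := monotone_nat_of_le_succ fun e r hr ↦ by
      rw [hJ] at hr ⊢
      intro c hc
      rw [Function.iterate_succ_apply]
      exact hr _ (hCκ c hc)
    obtain ⟨n, hn⟩ := monotone_stabilizes_iff_noetherian.2 (inferInstanceAs (IsNoetherian A A))
      ⟨J, hJmono⟩
    replace hn (m : ℕ) (hm : n ≤ m) : J n = J m := hn m hm
    have hcomap : (J n).comap σ ≤ J n := fun r hr ↦ by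
      rw [hn (n + 1) n.le_succ, hJ]
      intro c hc
      rw [Ideal.mem_comap, hJ] at hr
      rw [Function.iterate_succ_apply', ← map_smul, ← hκ, hφκ, map_smul, hr c hc]
      exact (AddMonoidHom.mk' κ' hadd').map_zero
    have hmaps (k : ℕ) : Set.MapsTo (PrimeSpectrum.comap (σ ^ k))
        (PrimeSpectrum.zeroLocus (J n : Set A)) (PrimeSpectrum.zeroLocus (J n)) := by
      induction k with
      | zero => exact fun _ h ↦ h
      | succ k ih => exact (PrimeSpectrum.mapsTo_comap_zeroLocus hσ hcomap).comp ih
    have hpJ : J n ≤ p.asIdeal := by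
      obtain ⟨q, hJq, hq, hqp⟩ := Ideal.exists_ideal_comap_le_prime (f := σ ^ d) p.asIdeal (J n) (by
        intro t ht
        rw [Ideal.mem_comap, hJ] at ht
        obtain ⟨c, hc, hr⟩ := hp (d + n)
        by_contra htp
        refine hr t htp ?_
        rw [Function.iterate_add_apply, ← hκe]
        exact hd _ ⟨by simpa using ht c hc, C.smul_mem _ (hCe n c hc)⟩)
      exact (hmaps d (show (⟨q, hq⟩ : PrimeSpectrum A) ∈ _ from hJq)).trans hqp
    intro e
    refine Module.mem_support_iff_of_finite.2 (le_trans (fun r hr ↦ ?_) hpJ)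
    rw [hn _ (le_max_left n e)]
    refine hJmono (le_max_right n e) ((hJ e r).2 fun c _ ↦ ?_)
    have hmem : φ (κ^[e] c) ∈ K e := by
      rw [← SetLike.mem_coe, hK, hφe]
      exact ⟨_, rfl⟩
    exact congrArg Subtype.val (Module.mem_annihilator.1 hr ⟨_, hmem⟩)


/-- Corollary 4.3.14: the crystalline support is well defined. If `M` is a `σ`-Cartier
module over a Noetherian ring `A` (with `Spec σ` bijective) containing a finitely generated
`κ`-stable submodule `C` with `M/C` locally nilpotent, and `φ₁ : M → N₁`, `φ₂ : M → N₂` are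
nil-isomorphisms onto finitely generated `σ`-Cartier modules, then `N₁` and `N₂` have the
same crystalline support `⋂_e Supp(κ^e(·))`. -/
theorem stmt_19 {A : Type*} [CommRing A] [IsNoetherianRing A]
    (σ : A →+* A) (hσ : Function.Bijective (PrimeSpectrum.comap σ))
    {M N₁ N₂ : Type*} [AddCommGroup M] [Module A M]
    [AddCommGroup N₁] [Module A N₁] [Module.Finite A N₁]
    [AddCommGroup N₂] [Module A N₂] [Module.Finite A N₂]
    (κ : M → M) (κ₁ : N₁ → N₁) (κ₂ : N₂ → N₂)
    (hadd : ∀ x y : M, κ (x + y) = κ x + κ y)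
    (hκ : ∀ (a : A) (m : M), κ (σ a • m) = a • κ m)
    (hadd₁ : ∀ x y : N₁, κ₁ (x + y) = κ₁ x + κ₁ y)
    (hκ₁ : ∀ (a : A) (m : N₁), κ₁ (σ a • m) = a • κ₁ m)
    (hadd₂ : ∀ x y : N₂, κ₂ (x + y) = κ₂ x + κ₂ y)
    (hκ₂ : ∀ (a : A) (m : N₂), κ₂ (σ a • m) = a • κ₂ m)
    -- `M` contains a finitely generated `κ`-stable submodule `C` with `M/C` locally nilpotent
    (hC : ∃ C : Submodule A M, C.FG ∧ (∀ x ∈ C, κ x ∈ C) ∧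
      ∀ m : M, ∃ N : Submodule A M, C ≤ N ∧ m ∈ N ∧ (∀ x ∈ N, κ x ∈ N) ∧
        ∃ e : ℕ, ∀ x ∈ N, κ^[e] x ∈ C)
    (φ₁ : M →ₗ[A] N₁) (hφ₁κ : ∀ x : M, φ₁ (κ x) = κ₁ (φ₁ x))
    (φ₂ : M →ₗ[A] N₂) (hφ₂κ : ∀ x : M, φ₂ (κ x) = κ₂ (φ₂ x))
    -- the kernel of `φ₁` is locally nilpotent
    (hker₁ : ∀ m ∈ LinearMap.ker φ₁, ∃ P : Submodule A M, P ≤ LinearMap.ker φ₁ ∧ m ∈ P ∧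
      (∀ x ∈ P, κ x ∈ P) ∧ ∃ e : ℕ, ∀ x ∈ P, κ^[e] x = 0)
    -- the cokernel of `φ₁` is locally nilpotent
    (hcoker₁ : ∀ y : N₁, ∃ P : Submodule A N₁, LinearMap.range φ₁ ≤ P ∧ y ∈ P ∧
      (∀ x ∈ P, κ₁ x ∈ P) ∧ ∃ e : ℕ, ∀ x ∈ P, κ₁^[e] x ∈ LinearMap.range φ₁)
    -- the kernel of `φ₂` is locally nilpotent
    (hker₂ : ∀ m ∈ LinearMap.ker φ₂, ∃ P : Submodule A M, P ≤ LinearMap.ker φ₂ ∧ m ∈ P ∧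
      (∀ x ∈ P, κ x ∈ P) ∧ ∃ e : ℕ, ∀ x ∈ P, κ^[e] x = 0)
    -- the cokernel of `φ₂` is locally nilpotent
    (hcoker₂ : ∀ y : N₂, ∃ P : Submodule A N₂, LinearMap.range φ₂ ≤ P ∧ y ∈ P ∧
      (∀ x ∈ P, κ₂ x ∈ P) ∧ ∃ e : ℕ, ∀ x ∈ P, κ₂^[e] x ∈ LinearMap.range φ₂)
    -- `K₁ e` is the `A`-submodule `κ₁^e(N₁)` of `N₁`, and similarly `K₂ e`
    (K₁ : ℕ → Submodule A N₁) (hK₁ : ∀ e : ℕ, (K₁ e : Set N₁) = Set.range (κ₁^[e]))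
    (K₂ : ℕ → Submodule A N₂) (hK₂ : ∀ e : ℕ, (K₂ e : Set N₂) = Set.range (κ₂^[e])) :
    (⋂ e : ℕ, Module.support A ↥(K₁ e)) = ⋂ e : ℕ, Module.support A ↥(K₂ e) := by
  obtain ⟨C, hCfg, hCκ, hC⟩ := hC
  ext p
  rw [mem_iInter_support_iff_of_nilIsomorphism hσ.1 hadd hκ hadd₁ hCfg hCκ
      (fun m ↦ (hC m).imp fun _ h ↦ ⟨h.2.1, h.2.2.2⟩) hφ₁κ
      (fun m hm ↦ (hker₁ m hm).imp fun _ h ↦ ⟨h.2.1, h.2.2.2⟩)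
      (fun y ↦ (hcoker₁ y).imp fun _ h ↦ ⟨h.2.1, h.2.2.2⟩) hK₁,
    mem_iInter_support_iff_of_nilIsomorphism hσ.1 hadd hκ hadd₂ hCfg hCκ
      (fun m ↦ (hC m).imp fun _ h ↦ ⟨h.2.1, h.2.2.2⟩) hφ₂κ
      (fun m hm ↦ (hker₂ m hm).imp fun _ h ↦ ⟨h.2.1, h.2.2.2⟩)
      (fun y ↦ (hcoker₂ y).imp fun _ h ↦ ⟨h.2.1, h.2.2.2⟩) hK₂]
end
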